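/- Given integers n > k ≥ 1, a quadratic n-fold Pfister form ψ over a field F, and two k-fold quadratic Pfister forms φ₁ and φ₂ that are both Pfister factors of ψ, there exists a single (n−k)-fold bilinear Pfister form ρ such that ψ ≅ φ₁ ⊗ ρ and ψ ≅ φ₂ ⊗ ρ. -/

import Mathlib

noncomputable section

open QuadraticMap

/-- A quadratic form over `F` on the space `F^d`, bundled together with its dimension `d`. -/
structure QF (F : Type) [Field F] where
  dim : ℕ
  form : QuadraticForm F (Fin dim → F)

namespace QF

variable {F : Type} [Field F]

/-- Isometry of bundled quadratic forms. -/
def Equiv (q q' : QF F) : Prop := QuadraticMap.Equivalent q.form q'.form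

/-- The standard linear equivalence `F^(a+b) ≃ F^a × F^b`. -/
def finSplit (F : Type) [Field F] (a b : ℕ) :
    (Fin (a + b) → F) ≃ₗ[F] (Fin a → F) × (Fin b → F) :=
  (LinearEquiv.funCongrLeft F F finSumFinEquiv).trans
    (LinearEquiv.sumArrowLequivProdArrow _ _ F F)

/-- Orthogonal sum of bundled quadratic forms. -/
def sum (q₁ q₂ : QF F) : QF F :=
  ⟨q₁.dim + q₂.dim, (q₁.form.prod q₂.form).comp (finSplit F q₁.dim q₂.dim).toLinearMap⟩

instance : Neg (QF F) := ⟨fun q => ⟨q.dim, -q.form⟩⟩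

instance : SMul F (QF F) := ⟨fun a q => ⟨q.dim, a • q.form⟩⟩

/-- `⟨⟨γ⟩⟩ ⊗ q = q ⊥ (−γ)·q` : twisting a quadratic form by the
1-fold bilinear Pfister form `⟨⟨γ⟩⟩ = ⟨1, −γ⟩`. -/
def twist (γ : F) (q : QF F) : QF F := q.sum ((-γ) • q)

/-- `⟨⟨γ₁,…,γ_m⟩⟩ ⊗ q` : tensoring a quadratic form with the `m`-fold bilinear
Pfister form whose slots are the entries of the list `l = [γ₁,…,γ_m]`. -/
def btensor (l : List F) (q : QF F) : QF F := l.foldr twist q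

/-- The zero form on the zero space. -/
def zero (F : Type) [Field F] : QF F := ⟨0, 0⟩

/-- The one-dimensional form `⟨1⟩`, `x ↦ x²`. -/
def unit (F : Type) [Field F] : QF F := ⟨1, QuadraticMap.sq.comp (LinearMap.proj 0)⟩

/-- The binary quadratic form `[1,α] : (x,y) ↦ x² + xy + αy²`. -/
def binary (α : F) : QF F := ⟨2, (Matrix.of ![![1, 1], ![0, α]]).toQuadraticMap'⟩

/-- The hyperbolic plane `ℍ : (x,y) ↦ xy`. -/
def hyp (F : Type) [Field F] : QF F := ⟨2, (Matrix.of ![![0, 1], ![0, 0]]).toQuadraticMap'⟩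

/-- `m × ℍ`, the orthogonal sum of `m` hyperbolic planes. -/
def hyps (F : Type) [Field F] : ℕ → QF F
  | 0 => zero F
  | n + 1 => (hyp F).sum (hyps F n)

/-- A quadratic form is isotropic if it represents `0` nontrivially. -/
def Isotropic (q : QF F) : Prop := ∃ v, q.form v = 0 ∧ v ≠ 0

/-- A quadratic form is hyperbolic if it is isometric to an orthogonal
sum of hyperbolic planes. -/
def Hyperbolic (q : QF F) : Prop := ∃ m, q.Equiv (hyps F m)

/-- All entries of the list are nonzero (the slots of a bilinear Pfister form
must be units). -/
def UnitList (l : List F) : Prop := ∀ γ ∈ l, γ ≠ 0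

/-- `q` is an `n`-fold quadratic Pfister form.  In characteristic `2` this means
`q ≅ ⟨⟨γ₁,…,γ_{n−1}, α]] = ⟨⟨γ₁,…,γ_{n−1}⟩⟩ ⊗ [1,α]`; in characteristic `≠ 2` it means
`q ≅ ⟨⟨γ₁,…,γ_n⟩⟩ = ⟨1,−γ₁⟩ ⊗ ⋯ ⊗ ⟨1,−γ_n⟩`. -/
def IsQPfister (n : ℕ) (q : QF F) : Prop :=
  if ringChar F = 2 then
    ∃ (l : List F) (α : F), UnitList l ∧ l.length + 1 = n ∧ (btensor l (binary α)).Equiv q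
  else
    ∃ l : List F, UnitList l ∧ l.length = n ∧ (btensor l (unit F)).Equiv q

/-- `φ` is a `k`-fold quadratic Pfister factor of `ψ`, i.e. `ψ ≅ B ⊗ φ` for some
bilinear Pfister form `B`. -/
def IsQPfisterFactor (k : ℕ) (φ ψ : QF F) : Prop :=
  IsQPfister k φ ∧ ∃ l : List F, UnitList l ∧ (btensor l φ).Equiv ψ

/-- A finite family of quadratic Pfister forms is (separably) `k`-linked if its members
share a common `k`-fold quadratic Pfister factor. -/
def SepLinked (k : ℕ) (ψs : List (QF F)) : Prop :=
  ∃ π : QF F, IsQPfister k π ∧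
    ∀ ψ ∈ ψs, ∃ l : List F, UnitList l ∧ (btensor l π).Equiv ψ

/-- A finite family of quadratic Pfister forms is inseparably `k`-linked if its members
share a common `k`-fold bilinear Pfister factor. -/
def InsepLinked (k : ℕ) (ψs : List (QF F)) : Prop :=
  ∃ l : List F, UnitList l ∧ l.length = k ∧
    ∀ ψ ∈ ψs, ∃ (n : ℕ) (π : QF F), IsQPfister n π ∧ (btensor l π).Equiv ψ

/-- `q` is the value of the two-form invariant `F²_k(ψ₁, ψ₂) = φ₁ ⊗ φ₂ ⊗ π`
for some presentation `ψ₁ ≅ φ₁ ⊗ π`, `ψ₂ ≅ φ₂ ⊗ π`. -/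
def IsPairInv (k : ℕ) (ψ₁ ψ₂ q : QF F) : Prop :=
  ∃ (π : QF F) (l₁ l₂ : List F), IsQPfister k π ∧ UnitList l₁ ∧ UnitList l₂ ∧
    (btensor l₁ π).Equiv ψ₁ ∧ (btensor l₂ π).Equiv ψ₂ ∧
    q.Equiv (btensor l₁ (btensor l₂ π))

/-- `IsInv k ψs q` : `q` is a value of the inductively defined invariant
`F^m_k(ψ₁,…,ψ_m)`, where `F¹_k(ψ) = ψ` and
`F^m_k(ψ₁,…,ψ_m) = F²_k(F^{m−1}_k(ψ₁,…,ψ_{m−1}), ψ_m)`. -/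
inductive IsInv (k : ℕ) : List (QF F) → QF F → Prop
  | single (ψ : QF F) : IsInv k [ψ] ψ
  | step {ψs : List (QF F)} {ψ q' q : QF F} :
      IsInv k ψs q' → IsPairInv k q' ψ q → IsInv k (ψs ++ [ψ]) q

end QF
namespace QF

variable {F : Type} [Field F]

/-- The (upper triangular) Gram-type matrix of a bundled quadratic form:
`q(∑ xᵢ eᵢ) = ∑ᵢ q(eᵢ) xᵢ² + ∑_{i<j} polar(eᵢ,eⱼ) xᵢ xⱼ`. -/
def matrixOf (q : QF F) : Matrix (Fin q.dim) (Fin q.dim) F := fun i j =>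
  if i = j then q.form (Pi.single i 1)
  else if i < j then polar q.form (Pi.single i 1) (Pi.single j 1)
  else 0

/-- Base change (extension of scalars) of a bundled quadratic form along a
ring homomorphism of fields. -/
def baseChange {E : Type} [Field E] (σ : F →+* E) (q : QF F) : QF E :=
  ⟨q.dim, (q.matrixOf.map σ).toQuadraticMap'⟩

/-- The homogeneous degree-2 polynomial cut out by a bundled quadratic form. -/
def toPoly (q : QF F) : MvPolynomial (Fin q.dim) F :=
  ∑ i, ∑ j, MvPolynomial.C (q.matrixOf i j) * (MvPolynomial.X i * MvPolynomial.X j)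

/-- The affine coordinate ring of the quadric `q = 0`. -/
def coordRing (q : QF F) : Type :=
  MvPolynomial (Fin q.dim) F ⧸ Ideal.span {q.toPoly}

instance (q : QF F) : CommRing q.coordRing := Ideal.Quotient.commRing _
instance (q : QF F) : Algebra F q.coordRing := Ideal.Quotient.algebra F

/-- The function field `F(q)` of the quadric `q = 0` (assuming the coordinate
ring is a domain). -/
def funField (q : QF F) : Type := FractionRing q.coordRing

instance (q : QF F) : CommRing q.funField := by unfold funField; infer_instance

noncomputable instance (q : QF F) [IsDomain q.coordRing] : Field q.funField := by
  unfold funField; infer_instance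

/-- The canonical embedding `F → F(q)`. -/
noncomputable def toFunField (q : QF F) : F →+* q.funField :=
  (algebraMap q.coordRing (FractionRing q.coordRing)).comp (algebraMap F q.coordRing)

/-- `⟨⟨γ₁,…,γ_m⟩⟩′ ⊗ q` : the tensor product with `q` of the pure part of the
bilinear Pfister form with slots `γ₁,…,γ_m`, so that
`⟨⟨l⟩⟩ ⊗ q ≅ q ⊥ (⟨⟨l⟩⟩′ ⊗ q)`. -/
def bpure : List F → QF F → QF F
  | [], _ => zero F
  | γ :: l, q => (bpure l q).sum ((-γ) • btensor l q)

end QF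

namespace QF

variable {F : Type} [Field F]

theorem Equiv.refl (q : QF F) : q.Equiv q := QuadraticMap.Equivalent.refl _

theorem Equiv.symm {p q : QF F} (h : p.Equiv q) : q.Equiv p := QuadraticMap.Equivalent.symm h

theorem Equiv.trans {p q r : QF F} (h : p.Equiv q) (h' : q.Equiv r) : p.Equiv r :=
  QuadraticMap.Equivalent.trans h h'

theorem equivalent_prod (p q : QF F) : (p.sum q).form.Equivalent (p.form.prod q.form) :=
  ⟨⟨finSplit F p.dim q.dim, fun _ => rfl⟩⟩

theorem smul_form_apply (c : F) (q : QF F) (v : Fin q.dim → F) :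
    (c • q).form v = c * q.form v := rfl

theorem Equiv.sum {p p' q q' : QF F} (hp : p.Equiv p') (hq : q.Equiv q') :
    (p.sum q).Equiv (p'.sum q') :=
  ((equivalent_prod p q).trans (QuadraticMap.Equivalent.prod hp hq)).trans
    (equivalent_prod p' q').symm

theorem Equiv.smul (c : F) {p q : QF F} (h : p.Equiv q) : (c • p).Equiv (c • q) := by
  obtain ⟨e⟩ := h
  exact ⟨⟨e.toLinearEquiv, fun v => congrArg (c * ·) (e.map_app v)⟩⟩

theorem Equiv.dim_eq {p q : QF F} (h : p.Equiv q) : p.dim = q.dim := by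
  obtain ⟨e⟩ := h
  simpa using e.toLinearEquiv.finrank_eq

theorem sum_comm (p q : QF F) : (p.sum q).Equiv (q.sum p) :=
  ((equivalent_prod p q).trans ⟨QuadraticMap.IsometryEquiv.prodComm _ _⟩).trans
    (equivalent_prod q p).symm

theorem sum_assoc (p q r : QF F) : ((p.sum q).sum r).Equiv (p.sum (q.sum r)) := by
  refine ((equivalent_prod _ _).trans ((equivalent_prod p q).prod (.refl r.form))).trans
    (.trans ?_ ((equivalent_prod _ _).trans
      ((QuadraticMap.Equivalent.refl p.form).prod (equivalent_prod q r))).symm)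
  exact ⟨⟨LinearEquiv.prodAssoc F _ _ _, fun v => by simp [add_assoc]⟩⟩

theorem zero_sum (q : QF F) : ((zero F).sum q).Equiv q := by
  refine (equivalent_prod _ _).trans ⟨⟨LinearEquiv.uniqueProd (R := F) (M₂ := Fin 0 → F), ?_⟩⟩
  exact fun v => (zero_add _).symm

theorem smul_sum (c : F) (p q : QF F) : (c • p.sum q).Equiv ((c • p).sum (c • q)) :=
  ⟨⟨LinearEquiv.refl F _, fun _ => (mul_add c _ _).symm⟩⟩

theorem smul_smul (c d : F) (q : QF F) : (c • d • q).Equiv ((c * d) • q) :=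
  ⟨⟨LinearEquiv.refl F _, fun _ => mul_assoc c d _⟩⟩

theorem one_smul (q : QF F) : ((1 : F) • q).Equiv q :=
  ⟨⟨LinearEquiv.refl F _, fun _ => (one_mul _).symm⟩⟩

theorem smul_zero (c : F) : (c • zero F).Equiv (zero F) :=
  ⟨⟨LinearEquiv.refl F _, fun _ => (mul_zero c).symm⟩⟩

instance isometrySetoid (F : Type) [Field F] : Setoid (QF F) where
  r := Equiv
  iseqv := ⟨Equiv.refl, Equiv.symm, Equiv.trans⟩

/-- Isometry classes of quadratic forms. -/
def IsoClass (F : Type) [Field F] : Type := Quotient (isometrySetoid F)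

/-- The isometry class of a quadratic form. -/
def cls (q : QF F) : IsoClass F := Quotient.mk _ q

theorem cls_eq_cls {p q : QF F} : cls p = cls q ↔ p.Equiv q := Quotient.eq

namespace IsoClass

instance : Zero (IsoClass F) := ⟨cls (QF.zero F)⟩

instance : Add (IsoClass F) := ⟨Quotient.map₂ QF.sum fun _ _ hp _ _ hq => hp.sum hq⟩

instance : AddCommMonoid (IsoClass F) where
  add_assoc := by rintro ⟨p⟩ ⟨q⟩ ⟨r⟩; exact Quotient.sound (sum_assoc p q r)
  zero_add := by rintro ⟨q⟩; exact Quotient.sound (zero_sum q)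
  add_zero := by rintro ⟨q⟩; exact Quotient.sound ((sum_comm _ _).trans (zero_sum q))
  add_comm := by rintro ⟨p⟩ ⟨q⟩; exact Quotient.sound (sum_comm p q)
  nsmul := nsmulRec

instance : DistribMulAction F (IsoClass F) where
  smul c := Quotient.map (c • ·) fun _ _ h => Equiv.smul c h
  one_smul := by rintro ⟨q⟩; exact Quotient.sound (QF.one_smul q)
  mul_smul := by rintro c d ⟨q⟩; exact Quotient.sound (QF.smul_smul c d q).symm
  smul_zero c := Quotient.sound (QF.smul_zero c)
  smul_add := by rintro c ⟨p⟩ ⟨q⟩; exact Quotient.sound (QF.smul_sum c p q)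

end IsoClass

theorem cls_sum (p q : QF F) : cls (p.sum q) = cls p + cls q := rfl

theorem cls_smul (c : F) (q : QF F) : cls (c • q) = c • cls q := rfl

theorem cls_twist (c : F) (q : QF F) : cls (twist c q) = cls q + (-c) • cls q := rfl

theorem Equiv.twist (c : F) {p q : QF F} (h : p.Equiv q) : (twist c p).Equiv (twist c q) :=
  h.sum (h.smul _)

theorem Equiv.btensor (l : List F) {p q : QF F} (h : p.Equiv q) :
    (btensor l p).Equiv (btensor l q) := by
  induction l with
  | nil => exact h
  | cons c l ih => exact ih.twist c

theorem twist_comm (c d : F) (q : QF F) : (twist c (twist d q)).Equiv (twist d (twist c q)) := by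
  rw [← cls_eq_cls]
  simp only [cls_twist, smul_add, _root_.smul_smul, neg_mul_neg, mul_comm c d]
  abel

theorem btensor_append (l l' : List F) (q : QF F) :
    btensor (l ++ l') q = btensor l (btensor l' q) := List.foldr_append

theorem btensor_cons (c : F) (l : List F) (q : QF F) :
    btensor (c :: l) q = twist c (btensor l q) := rfl

theorem twist_btensor (c : F) (l : List F) (q : QF F) :
    (twist c (btensor l q)).Equiv (btensor l (twist c q)) := by
  induction l with
  | nil => exact .refl _
  | cons d l ih => exact (twist_comm c d _).trans (ih.twist d)

/-- `⟨a, b⟩ ≅ ⟨a + b, ab(a + b)⟩`, tensored with an arbitrary quadratic form. -/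
theorem smul_sum_smul_equiv {a b : F} (hab : a + b ≠ 0) (q : QF F) :
    ((a • q).sum (b • q)).Equiv (((a + b) • q).sum ((a * b * (a + b)) • q)) := by
  refine ((equivalent_prod _ _).trans (.symm ?_)).trans (equivalent_prod _ _).symm
  refine ⟨⟨{
    toFun := fun v => (v.1 - b • v.2, v.1 + a • v.2)
    invFun := fun v => ((a + b)⁻¹ • (a • v.1 + b • v.2), (a + b)⁻¹ • (v.2 - v.1))
    map_add' := fun v w => by ext <;> simp <;> ring
    map_smul' := fun c v => by ext <;> simp <;> ring
    left_inv := fun v => by ext <;> simp <;> field_simp; ring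
    right_inv := fun v => by ext <;> simp <;> field_simp <;> ring }, ?_⟩⟩
  rintro ⟨u, v⟩
  have h₁ := QuadraticMap.map_add q.form u (-(b • v))
  have h₂ := QuadraticMap.map_add q.form u (a • v)
  rw [QuadraticMap.polar_neg_right, QuadraticMap.map_neg] at h₁
  rw [QuadraticMap.polar_smul_right, QuadraticMap.map_smul] at h₁ h₂
  change a * q.form (u - b • v) + b * q.form (u + a • v) =
    (a + b) * q.form u + (a * b * (a + b)) * q.form v
  rw [sub_eq_add_neg, h₁, h₂]
  simp only [smul_eq_mul]
  ring

theorem IsoClass.smul_add_smul {a b : F} (hab : a + b ≠ 0) (x : IsoClass F) :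
    a • x + b • x = (a + b) • x + (a * b * (a + b)) • x := by
  induction x using Quotient.inductionOn with
  | h q => exact Quotient.sound (smul_sum_smul_equiv hab q)

theorem IsoClass.mul_self_smul {c : F} (hc : c ≠ 0) (x : IsoClass F) : (c * c) • x = x := by
  induction x using Quotient.inductionOn with
  | h q =>
    refine Quotient.sound ⟨⟨LinearEquiv.smulOfNeZero F (Fin q.dim → F) c hc, fun v => ?_⟩⟩
    exact QuadraticMap.map_smul q.form c v

/-- `⟨⟨a, b⟩⟩ ≅ ⟨⟨a + b, -ab⟩⟩`, tensored with an arbitrary quadratic form. -/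
theorem twist_twist_equiv {a b : F} (hab : a + b ≠ 0) (q : QF F) :
    (twist b (twist a q)).Equiv (twist (-(a * b)) (twist (a + b) q)) := by
  have h : -a + -b ≠ 0 := by rwa [← neg_add, neg_ne_zero]
  rw [← cls_eq_cls]
  have key := IsoClass.smul_add_smul h (cls q)
  simp only [cls_twist, smul_add, _root_.smul_smul]
  calc _ = cls q + ((-a) • cls q + (-b) • cls q) + (-b * -a) • cls q := by abel
    _ = _ := by
      rw [key, ← neg_add, neg_neg, show -b * -a = a * b by ring,
        show -a * -b * -(a + b) = a * b * -(a + b) by ring]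
      abel

/-- The vector of `p ⊥ q` with the given components. -/
def pair (p q : QF F) (u : Fin p.dim → F) (v : Fin q.dim → F) : Fin (p.sum q).dim → F :=
  (finSplit F p.dim q.dim).symm (u, v)

theorem form_pair (p q : QF F) (u : Fin p.dim → F) (v : Fin q.dim → F) :
    (p.sum q).form (pair p q u v) = p.form u + q.form v := by
  change p.form ((finSplit F _ _) ((finSplit F _ _).symm (u, v))).1 +
    q.form ((finSplit F _ _) ((finSplit F _ _).symm (u, v))).2 = _
  rw [LinearEquiv.apply_symm_apply]

theorem exists_eq_pair (p q : QF F) (w : Fin (p.sum q).dim → F) :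
    ∃ u v, w = pair p q u v :=
  ⟨(finSplit F p.dim q.dim w).1, (finSplit F p.dim q.dim w).2,
    ((finSplit F p.dim q.dim).symm_apply_apply w).symm⟩

theorem pair_add (p q : QF F) (u u' : Fin p.dim → F) (v v' : Fin q.dim → F) :
    pair p q u v + pair p q u' v' = pair p q (u + u') (v + v') :=
  (map_add (finSplit F p.dim q.dim).symm (u, v) (u', v')).symm

theorem pair_zero (p q : QF F) : pair p q 0 0 = 0 :=
  map_zero (finSplit F p.dim q.dim).symm

theorem polar_pair (p q : QF F) (u u' : Fin p.dim → F) (v v' : Fin q.dim → F) :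
    polar (p.sum q).form (pair p q u v) (pair p q u' v') =
      polar p.form u u' + polar q.form v v' := by
  simp only [polar, pair_add, form_pair]
  ring

theorem polar_smul_form (c : F) (q : QF F) (u v : Fin q.dim → F) :
    polar (c • q).form u v = c * polar q.form u v := by
  change c * _ - c * _ - c * _ = _
  simp only [polar]
  ring

theorem form_twist_pair (c : F) (q : QF F) (u v : Fin q.dim → F) :
    (twist c q).form (pair q ((-c) • q) u v) = q.form u + -c * q.form v :=
  form_pair q ((-c) • q) u v

theorem polar_twist_pair (c : F) (q : QF F) (u v u' v' : Fin q.dim → F) :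
    polar (twist c q).form (pair q ((-c) • q) u v) (pair q ((-c) • q) u' v') =
      polar q.form u u' + -c * polar q.form v v' :=
  (polar_pair q ((-c) • q) u u' v v').trans (by rw [polar_smul_form])

/-- The polar form of `q` has trivial radical. -/
def Regular (q : QF F) : Prop := ∀ u, (∀ v, polar q.form u v = 0) → u = 0

theorem Regular.twist {q : QF F} (h : q.Regular) {c : F} (hc : c ≠ 0) : (twist c q).Regular := by
  intro w hw
  obtain ⟨u, v, rfl⟩ := exists_eq_pair q ((-c) • q) w
  have hu : u = 0 := h u fun x => by
    have := hw (pair q ((-c) • q) x 0)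
    rwa [polar_twist_pair, polar_zero_right, mul_zero, add_zero] at this
  have hv : v = 0 := h v fun x => by
    have := hw (pair q ((-c) • q) 0 x)
    rw [polar_twist_pair, polar_zero_right, zero_add] at this
    exact (mul_eq_zero.mp this).resolve_left (neg_ne_zero.mpr hc)
  rw [hu, hv]
  exact pair_zero q ((-c) • q)

theorem Regular.congr {p q : QF F} (h : p.Regular) (e : p.Equiv q) : q.Regular := by
  obtain ⟨e⟩ := e
  intro u hu
  have : e.symm u = 0 := h _ fun v => by
    have := hu (e v)
    simp only [polar] at this ⊢
    rw [← e.map_app, ← e.map_app (e.symm u), ← e.map_app v]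
    have h2 : e (e.symm u + v) = u + e v := by
      rw [show e (e.symm u + v) = e (e.symm u) + e v from map_add e.toLinearEquiv _ _,
        e.apply_symm_apply]
    rw [h2, e.apply_symm_apply, this]
  have h3 := congrArg e this
  rwa [e.apply_symm_apply, show e 0 = 0 from map_zero e.toLinearEquiv] at h3

/-- A form is round if it is similar to itself by every nonzero value it represents. -/
def Round (q : QF F) : Prop := ∀ v, q.form v ≠ 0 → (q.form v • q).Equiv q

theorem Round.congr {p q : QF F} (h : p.Round) (e : p.Equiv q) : q.Round := by
  intro v hv
  have e' := e
  obtain ⟨f⟩ := e'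
  have hf : p.form (f.symm v) = q.form v := f.symm.map_app v
  rw [← hf] at hv ⊢
  exact ((e.symm.smul _).trans (h _ hv)).trans e

theorem Round.twist {q : QF F} (h : q.Round) {c : F} (hc : c ≠ 0) : (twist c q).Round := by
  intro w hw
  obtain ⟨u, v, rfl⟩ := exists_eq_pair q ((-c) • q) w
  rw [form_twist_pair] at hw ⊢
  have hu := h u
  have hv := h v
  generalize q.form u = x at *
  generalize q.form v = y at *
  simp only [← cls_eq_cls, cls_smul, cls_twist] at hu hv ⊢
  by_cases hy : y = 0
  · subst hy
    have hx : x ≠ 0 := by simpa using hw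
    rw [mul_zero, add_zero, smul_add, smul_comm, hu hx]
  by_cases hx : x = 0
  · subst hx
    rw [zero_add, smul_add, mul_smul, hv hy, _root_.smul_smul,
      show -c * y * -c = c * c * y by ring, mul_smul, hv hy, IsoClass.mul_self_smul hc, add_comm]
  · calc _ = (x + -c * y) • cls q + (x * (-c * y) * (x + -c * y)) • cls q := by
          rw [smul_add]
          conv_lhs => enter [2, 2, 2]; rw [← hu hx, ← hv hy]
          simp only [_root_.smul_smul]
          congr 2
          ring
      _ = x • cls q + (-c * y) • cls q := (IsoClass.smul_add_smul hw _).symm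
      _ = _ := by rw [mul_smul, hv hy, hu hx]

theorem unitList_cons {c : F} {l : List F} : UnitList (c :: l) ↔ c ≠ 0 ∧ UnitList l :=
  List.forall_mem_cons

theorem unitList_append {l l' : List F} : UnitList (l ++ l') ↔ UnitList l ∧ UnitList l' :=
  List.forall_mem_append

theorem Round.btensor {q : QF F} (h : q.Round) {l : List F} (hl : UnitList l) :
    (btensor l q).Round := by
  induction l with
  | nil => exact h
  | cons c l ih =>
    rw [unitList_cons] at hl
    exact (ih hl.2).twist hl.1

theorem Regular.btensor {q : QF F} (h : q.Regular) {l : List F} (hl : UnitList l) :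
    (btensor l q).Regular := by
  induction l with
  | nil => exact h
  | cons c l ih =>
    rw [unitList_cons] at hl
    exact (ih hl.2).twist hl.1

theorem dim_btensor (l : List F) (q : QF F) : (btensor l q).dim = 2 ^ l.length * q.dim := by
  induction l with
  | nil => simp [QF.btensor]
  | cons c l ih =>
    change (QF.btensor l q).dim + (QF.btensor l q).dim = _
    rw [ih, List.length_cons, pow_succ]
    ring

theorem btensor_equiv_sum_bpure (l : List F) (q : QF F) :
    (btensor l q).Equiv (q.sum (bpure l q)) := by
  rw [← cls_eq_cls, cls_sum]
  induction l with
  | nil => exact (add_zero (cls q)).symm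
  | cons c l ih =>
    rw [btensor_cons, cls_twist, bpure, cls_sum, cls_smul, ← add_assoc, ← ih]

/-- Pure subform theorem: the negative of a nonzero value of the pure part can be taken as a slot,
and that slot can be absorbed in the quadratic form. -/
theorem exists_btensor_equiv_of_bpure {q : QF F} (hq : q.Round) {l : List F} (hl : UnitList l)
    {c : F} (hc : c ≠ 0) {v : Fin (bpure l q).dim → F} (hv : (bpure l q).form v = -c) :
    ∃ l' : List F, UnitList l' ∧ l'.length + 1 = l.length ∧
      (btensor l q).Equiv (btensor l' (twist c q)) := by
  induction l generalizing c with
  | nil => exact absurd (neg_eq_zero.mp hv.symm) hc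
  | cons a l ih =>
    rw [unitList_cons] at hl
    obtain ⟨u, w, rfl⟩ := exists_eq_pair (bpure l q) ((-a) • btensor l q) v
    have hv' : (bpure l q).form u + -a * (btensor l q).form w = -c :=
      (form_pair (bpure l q) ((-a) • btensor l q) u w).symm.trans hv
    have hround := hq.btensor hl.2 w
    generalize (btensor l q).form w = y at hv' hround
    obtain ⟨x, hx⟩ : ∃ x, (bpure l q).form u = -x := ⟨_, (neg_neg _).symm⟩
    rw [hx] at hv'
    by_cases hy : y = 0
    · obtain rfl : x = c := by rw [hy] at hv'; linear_combination -hv'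
      obtain ⟨l', h₁, h₂, h₃⟩ := ih hl.2 hc hx
      exact ⟨a :: l', unitList_cons.mpr ⟨hl.1, h₁⟩, by simp [h₂], h₃.twist a⟩
    have hay : (twist a (btensor l q)).Equiv (twist (a * y) (btensor l q)) := by
      have h := cls_eq_cls.mpr (hround hy)
      rw [cls_smul] at h
      rw [← cls_eq_cls, cls_twist, cls_twist, ← neg_mul, mul_smul, h]
    have hcxy : c = x + a * y := by linear_combination hv'
    by_cases hx0 : x = 0
    · rw [hx0, zero_add] at hcxy
      exact ⟨l, hl.2, rfl, hcxy ▸ hay.trans (twist_btensor _ l q)⟩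
    · obtain ⟨l', h₁, h₂, h₃⟩ := ih hl.2 hx0 hx
      refine ⟨-(x * (a * y)) :: l', unitList_cons.mpr ⟨?_, h₁⟩, by simp [h₂], ?_⟩
      · exact neg_ne_zero.mpr (mul_ne_zero hx0 (mul_ne_zero hl.1 hy))
      · have h₄ := h₃.trans (twist_btensor x l' q).symm
        have h₅ := (h₄.twist (a * y)).trans (twist_twist_equiv (hcxy ▸ hc) _)
        rw [← hcxy] at h₅
        exact (hay.trans h₅).trans ((twist_btensor c l' q).twist _)

/-- In an anisotropic quadratic space, vectors of the same value are conjugate under an isometry. -/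
theorem exists_isometry_map_eq {V : Type*} [AddCommGroup V] [Module F V] [FiniteDimensional F V]
    {Q : QuadraticForm F V} (hQ : Q.Anisotropic) {u v : V} (huv : Q u = Q v) :
    ∃ e : Q.IsometryEquiv Q, e u = v := by
  by_cases h : u = v
  · exact ⟨.refl Q, h⟩
  have hw : Q (u - v) ≠ 0 := fun h0 => h (sub_eq_zero.mp (hQ _ h0))
  set w := u - v with hwdef
  let f : V →ₗ[F] V := LinearMap.id - ((Q w)⁻¹ • Q.polarBilin w).smulRight w
  have hf (x : V) : f x = x + (-((Q w)⁻¹ * polar Q w x)) • w := by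
    simp [f, sub_eq_add_neg]
  have hfQ (x : V) : Q (f x) = Q x := by
    rw [hf, QuadraticMap.map_add Q x, QuadraticMap.map_smul, QuadraticMap.polar_smul_right,
      QuadraticMap.polar_comm Q x w]
    simp only [smul_eq_mul]
    field_simp
    ring
  have hinj : Function.Injective f := by
    rw [injective_iff_map_eq_zero]
    intro x hx
    exact hQ x (by rw [← hfQ, hx, QuadraticMap.map_zero])
  refine ⟨⟨LinearEquiv.ofInjectiveEndo f hinj, hfQ⟩, ?_⟩
  change f u = v
  have hpol : polar Q w u = Q w := by
    have h1 := QuadraticMap.map_add Q w (-u)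
    rw [QuadraticMap.polar_neg_right, QuadraticMap.map_neg,
      show w + -u = -v by rw [hwdef]; abel, QuadraticMap.map_neg, huv] at h1
    linear_combination h1
  rw [hf, hpol, inv_mul_cancel₀ hw, neg_one_smul, hwdef]
  abel

/-- Two subspaces of complementary dimension with a common nonzero vector have a common nonzero
orthogonal vector. -/
theorem exists_common_orthogonal {V U₁ U₂ : Type*} [AddCommGroup V] [Module F V]
    [FiniteDimensional F V] [AddCommGroup U₁] [Module F U₁] [FiniteDimensional F U₁]
    [AddCommGroup U₂] [Module F U₂] [FiniteDimensional F U₂] (Q : QuadraticForm F V)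
    (f₁ : U₁ →ₗ[F] V) (f₂ : U₂ →ₗ[F] V) {u₁ : U₁} {u₂ : U₂} (hu₁ : u₁ ≠ 0)
    (hu : f₁ u₁ = f₂ u₂)
    (hdim : Module.finrank F U₁ + Module.finrank F U₂ ≤ Module.finrank F V) :
    ∃ w ≠ 0, (∀ x, polar Q w (f₁ x) = 0) ∧ ∀ x, polar Q w (f₂ x) = 0 := by
  let L : V →ₗ[F] Module.Dual F U₁ × Module.Dual F U₂ :=
    (Q.polarBilin.compl₂ f₁).prod (Q.polarBilin.compl₂ f₂)
  have hL : ¬ Function.Injective L := by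
    intro hinj
    have hle := LinearMap.finrank_le_finrank_of_injective hinj
    rw [Module.finrank_prod, Subspace.dual_finrank_eq, Subspace.dual_finrank_eq] at hle
    have hsurj := (LinearMap.injective_iff_surjective_of_finrank_eq_finrank (f := L) (by
      rw [Module.finrank_prod, Subspace.dual_finrank_eq, Subspace.dual_finrank_eq]
      omega)).mp hinj
    obtain ⟨g, hg⟩ := Module.Projective.exists_dual_ne_zero F hu₁
    obtain ⟨w, hw⟩ := hsurj (g, 0)
    have h1 : polar Q w (f₁ u₁) = g u₁ := DFunLike.congr_fun (congrArg Prod.fst hw) u₁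
    have h2 : polar Q w (f₂ u₂) = 0 := DFunLike.congr_fun (congrArg Prod.snd hw) u₂
    exact hg (by rw [← h1, hu, h2])
  rw [injective_iff_map_eq_zero] at hL
  push Not at hL
  obtain ⟨w, hw, hw0⟩ := hL
  exact ⟨w, hw0, fun x => DFunLike.congr_fun (congrArg Prod.fst hw) x,
    fun x => DFunLike.congr_fun (congrArg Prod.snd hw) x⟩

theorem exists_form_eq_of_orthogonal {p r q : QF F} (hp : p.Regular)
    (e : (p.sum r).form.IsometryEquiv q.form) {w : Fin q.dim → F}
    (hw : ∀ u, polar q.form w (e (pair p r u 0)) = 0) : ∃ v, r.form v = q.form w := by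
  obtain ⟨a, b, hab⟩ := exists_eq_pair p r (e.symm w)
  have ha : a = 0 := hp a fun u => by
    have h : polar (p.sum r).form (pair p r a b) (pair p r u 0) = 0 := by
      rw [← hab, ← hw u]
      simp only [polar]
      rw [← e.map_app, ← e.map_app (e.symm w), ← e.map_app (pair p r u 0),
        show e (e.symm w + _) = e (e.symm w) + e _ from map_add e.toLinearEquiv _ _,
        e.apply_symm_apply]
    rwa [polar_pair, polar_zero_right, add_zero] at h
  refine ⟨b, ?_⟩
  rw [← e.symm.map_app w, hab, form_pair, ha, QuadraticMap.map_zero, zero_add]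

theorem exists_common_slot {p₁ p₂ r₁ r₂ q : QF F} (hq : q.form.Anisotropic)
    (hp₁ : p₁.Regular) (hp₂ : p₂.Regular) (h₁ : (p₁.sum r₁).Equiv q) (h₂ : (p₂.sum r₂).Equiv q)
    (u₁ : ∃ v, p₁.form v = 1) (u₂ : ∃ v, p₂.form v = 1) (hdim : p₁.dim + p₂.dim ≤ q.dim) :
    ∃ c ≠ 0, (∃ v, r₁.form v = -c) ∧ ∃ v, r₂.form v = -c := by
  obtain ⟨e₁⟩ := h₁
  obtain ⟨e₂⟩ := h₂
  obtain ⟨u₁, hu₁⟩ := u₁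
  obtain ⟨u₂, hu₂⟩ := u₂
  have hval : q.form (e₁ (pair p₁ r₁ u₁ 0)) = q.form (e₂ (pair p₂ r₂ u₂ 0)) := by
    rw [e₁.map_app, e₂.map_app, form_pair, form_pair, hu₁, hu₂, QuadraticMap.map_zero,
      QuadraticMap.map_zero]
  obtain ⟨τ, hτ⟩ := exists_isometry_map_eq hq hval
  let e₁' := e₁.trans τ
  let f₁ := e₁'.toLinearEquiv.toLinearMap ∘ₗ (finSplit F p₁.dim r₁.dim).symm.toLinearMap ∘ₗ
    LinearMap.inl F _ _
  let f₂ := e₂.toLinearEquiv.toLinearMap ∘ₗ (finSplit F p₂.dim r₂.dim).symm.toLinearMap ∘ₗ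
    LinearMap.inl F _ _
  have hne : u₁ ≠ 0 := by
    rintro rfl
    rw [QuadraticMap.map_zero] at hu₁
    exact zero_ne_one hu₁
  obtain ⟨w, hw, hw₁, hw₂⟩ := exists_common_orthogonal q.form f₁ f₂ hne (u₂ := u₂) hτ (by simpa)
  refine ⟨-q.form w, neg_ne_zero.mpr fun h => hw (hq w h), ?_, ?_⟩
  · rw [neg_neg]
    exact exists_form_eq_of_orthogonal hp₁ e₁' hw₁
  · rw [neg_neg]
    exact exists_form_eq_of_orthogonal hp₂ e₂ hw₂

theorem exists_form_twist_eq_one {q : QF F} (h : ∃ v, q.form v = 1) (c : F) :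
    ∃ v, (twist c q).form v = 1 := by
  obtain ⟨v, hv⟩ := h
  refine ⟨pair q ((-c) • q) v 0, ?_⟩
  rw [form_twist_pair, hv, QuadraticMap.map_zero, mul_zero, add_zero]

theorem exists_common_complement_of_anisotropic {q : QF F} (hq : q.form.Anisotropic) {m : ℕ}
    {p₁ p₂ : QF F} (hr₁ : p₁.Round) (hr₂ : p₂.Round) (hp₁ : p₁.Regular) (hp₂ : p₂.Regular)
    (u₁ : ∃ v, p₁.form v = 1) (u₂ : ∃ v, p₂.form v = 1) {l₁ l₂ : List F}
    (hl₁ : UnitList l₁) (hl₂ : UnitList l₂) (hm₁ : l₁.length = m) (hm₂ : l₂.length = m)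
    (h₁ : (btensor l₁ p₁).Equiv q) (h₂ : (btensor l₂ p₂).Equiv q) :
    ∃ l : List F, UnitList l ∧ l.length = m ∧
      (btensor l p₁).Equiv q ∧ (btensor l p₂).Equiv q := by
  induction m generalizing p₁ p₂ l₁ l₂ with
  | zero =>
    obtain rfl := List.length_eq_zero_iff.mp hm₁
    obtain rfl := List.length_eq_zero_iff.mp hm₂
    exact ⟨[], hl₁, rfl, h₁, h₂⟩
  | succ m ih =>
    have hd₁ := h₁.dim_eq
    have hd₂ := h₂.dim_eq
    rw [dim_btensor, hm₁, pow_succ] at hd₁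
    rw [dim_btensor, hm₂, pow_succ] at hd₂
    have hdim : p₁.dim + p₂.dim ≤ q.dim := by
      have := Nat.one_le_two_pow (n := m)
      nlinarith
    obtain ⟨c, hc, ⟨v₁, hv₁⟩, v₂, hv₂⟩ := exists_common_slot hq hp₁ hp₂
      ((btensor_equiv_sum_bpure l₁ p₁).symm.trans h₁)
      ((btensor_equiv_sum_bpure l₂ p₂).symm.trans h₂) u₁ u₂ hdim
    obtain ⟨l₁', hl₁', hm₁', h₁'⟩ := exists_btensor_equiv_of_bpure hr₁ hl₁ hc hv₁
    obtain ⟨l₂', hl₂', hm₂', h₂'⟩ := exists_btensor_equiv_of_bpure hr₂ hl₂ hc hv₂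
    obtain ⟨l, hl, hm, he₁, he₂⟩ := ih (hr₁.twist hc) (hr₂.twist hc) (hp₁.twist hc)
      (hp₂.twist hc) (exists_form_twist_eq_one u₁ c) (exists_form_twist_eq_one u₂ c) hl₁' hl₂'
      (by omega) (by omega) (h₁'.symm.trans h₁) (h₂'.symm.trans h₂)
    refine ⟨l ++ [c], unitList_append.mpr ⟨hl, by simpa [UnitList] using hc⟩, by simp [hm], ?_, ?_⟩
    · rw [btensor_append]; exact he₁
    · rw [btensor_append]; exact he₂

/-- A linear map preserving quadratic forms of the same dimension is an isometry if the source
is regular. -/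
theorem Regular.equiv_of_linearMap {p q : QF F} (hp : p.Regular) (hdim : p.dim = q.dim)
    (f : (Fin p.dim → F) →ₗ[F] (Fin q.dim → F)) (hf : ∀ v, q.form (f v) = p.form v) :
    p.Equiv q := by
  have hinj : Function.Injective f := by
    rw [injective_iff_map_eq_zero]
    intro u hu
    refine hp u fun v => ?_
    simp only [polar]
    rw [← hf, ← hf u, ← hf v, map_add, hu, zero_add, QuadraticMap.map_zero]
    ring
  exact ⟨⟨f.linearEquivOfInjective hinj (by simpa), fun v => hf v⟩⟩

theorem Regular.smul {q : QF F} (h : q.Regular) {c : F} (hc : c ≠ 0) : (c • q).Regular :=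
  fun u hu => h u fun v =>
    (mul_eq_zero.mp ((polar_smul_form c q u v).symm.trans (hu v))).resolve_left hc

theorem binary_apply (α : F) (v : Fin 2 → F) :
    (binary α).form v = v 0 * v 0 + v 0 * v 1 + α * (v 1 * v 1) := by
  change Matrix.toLinearMap₂' F !![1, 1; 0, α] v v = _
  simp [Matrix.toLinearMap₂'_apply, Fin.sum_univ_two]
  ring

theorem hyp_apply (v : Fin 2 → F) : (hyp F).form v = v 0 * v 1 := by
  change Matrix.toLinearMap₂' F !![0, 1; 0, 0] v v = _
  simp [Matrix.toLinearMap₂'_apply, Fin.sum_univ_two]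

theorem polar_binary (α : F) (u v : Fin 2 → F) :
    polar (binary α).form u v =
      2 * u 0 * v 0 + u 0 * v 1 + u 1 * v 0 + 2 * α * (u 1 * v 1) := by
  have h := binary_apply α (u + v)
  change (binary α).form (u + v) - (binary α).form u - (binary α).form v = _
  rw [binary_apply α u, binary_apply α v]
  refine (congrArg (fun t => t - _ - _) h).trans ?_
  simp only [Pi.add_apply]
  ring

theorem polar_hyp (u v : Fin 2 → F) : polar (hyp F).form u v = u 0 * v 1 + u 1 * v 0 := by
  have h := hyp_apply (u + v)
  change (hyp F).form (u + v) - (hyp F).form u - (hyp F).form v = _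
  rw [hyp_apply u, hyp_apply v]
  refine (congrArg (fun t => t - _ - _) h).trans ?_
  simp only [Pi.add_apply]
  ring

theorem binary_regular {α : F} (hα : 1 - 4 * α ≠ 0) : (binary α).Regular := by
  intro (u : Fin 2 → F) hu
  have h₀ := (polar_binary α u ![1, 0]).symm.trans (hu _)
  have h₁ := (polar_binary α u ![0, 1]).symm.trans (hu _)
  simp only [Matrix.cons_val_zero, Matrix.cons_val_one] at h₀ h₁
  have e₀ : u 0 = 0 := by
    refine (mul_eq_zero.mp ?_).resolve_left hα
    linear_combination h₁ - 2 * α * h₀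
  have e₁ : u 1 = 0 := by
    refine (mul_eq_zero.mp ?_).resolve_left hα
    linear_combination h₀ - 2 * h₁
  exact funext (Fin.forall_fin_two.mpr ⟨e₀, e₁⟩)

theorem hyp_regular : (hyp F).Regular := by
  intro (u : Fin 2 → F) hu
  have h₀ := (polar_hyp u ![1, 0]).symm.trans (hu _)
  have h₁ := (polar_hyp u ![0, 1]).symm.trans (hu _)
  simp only [Matrix.cons_val_zero, Matrix.cons_val_one] at h₀ h₁
  have e₀ : u 0 = 0 := by linear_combination h₁
  have e₁ : u 1 = 0 := by linear_combination h₀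
  exact funext (Fin.forall_fin_two.mpr ⟨e₀, e₁⟩)

/-- The endomorphism of `F²` with matrix rows `(a, b)` and `(c, d)`. -/
def planeMap (a b c d : F) : (Fin 2 → F) →ₗ[F] (Fin 2 → F) where
  toFun v := ![a * v 0 + b * v 1, c * v 0 + d * v 1]
  map_add' u v := by ext i; fin_cases i <;> simp <;> ring
  map_smul' t v := by ext i; fin_cases i <;> simp <;> ring

theorem planeMap_apply_zero (a b c d : F) (v : Fin 2 → F) :
    planeMap a b c d v 0 = a * v 0 + b * v 1 := rfl

theorem planeMap_apply_one (a b c d : F) (v : Fin 2 → F) :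
    planeMap a b c d v 1 = c * v 0 + d * v 1 := rfl

theorem binary_round {α : F} (hα : 1 - 4 * α ≠ 0) : (binary α).Round := by
  intro (u : Fin 2 → F) hu
  refine ((binary_regular hα).smul hu).equiv_of_linearMap rfl
    (planeMap (u 0) (-(α * u 1)) (u 1) (u 0 + u 1)) fun (v : Fin 2 → F) => ?_
  refine (binary_apply α (planeMap (u 0) (-(α * u 1)) (u 1) (u 0 + u 1) v)).trans ?_
  refine Eq.trans ?_ (smul_form_apply _ (binary α) v).symm
  rw [binary_apply α u, binary_apply α v]
  simp only [planeMap_apply_zero, planeMap_apply_one]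
  ring

theorem binary_form_eq_one (α : F) : ∃ v, (binary α).form v = 1 :=
  ⟨(![1, 0] : Fin 2 → F), by
    refine (binary_apply α _).trans ?_
    simp⟩

theorem binary_equiv_hyp {α : F} (hα : 1 - 4 * α ≠ 0) (h : ¬ (binary α).form.Anisotropic) :
    (binary α).Equiv (hyp F) := by
  simp only [QuadraticMap.Anisotropic, not_forall] at h
  obtain ⟨(u : Fin 2 → F), hu, hu0⟩ := h
  replace hu := (binary_apply α u).symm.trans hu
  have h1 : u 1 ≠ 0 := by
    intro h1
    rw [h1] at hu
    have h0 : u 0 = 0 := by simpa using hu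
    exact hu0 (funext (Fin.forall_fin_two.mpr ⟨h0, h1⟩))
  obtain ⟨r, hr⟩ : ∃ r, r * r + r + α = 0 := by
    refine ⟨u 0 / u 1, ?_⟩
    field_simp
    linear_combination hu
  refine (binary_regular hα).equiv_of_linearMap rfl
    (planeMap 1 (-r) 1 (r + 1)) fun (v : Fin 2 → F) => ?_
  refine (hyp_apply (planeMap 1 (-r) 1 (r + 1) v)).trans ?_
  rw [binary_apply α v]
  simp only [planeMap_apply_zero, planeMap_apply_one]
  linear_combination -(v 1 * v 1) * hr

theorem smul_hyp_equiv {c : F} (hc : c ≠ 0) : (c • hyp F).Equiv (hyp F) := by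
  refine (hyp_regular.smul hc).equiv_of_linearMap rfl
    (planeMap c 0 0 1) fun (v : Fin 2 → F) => ?_
  refine (hyp_apply (planeMap c 0 0 1 v)).trans ?_
  refine Eq.trans ?_ (smul_form_apply c (hyp F) v).symm
  rw [hyp_apply v]
  simp only [planeMap_apply_zero, planeMap_apply_one]
  ring

theorem Regular.twist_equiv_of_linearMap {p q : QF F} (hp : p.Regular) (hdim : p.dim = q.dim)
    {c : F} (hc : c ≠ 0) (f g : ((Fin p.dim → F) × (Fin p.dim → F)) →ₗ[F] (Fin q.dim → F))
    (h : ∀ u v, q.form (f (u, v)) + -c * q.form (g (u, v)) = p.form u + -c * p.form v) :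
    (QF.twist c p).Equiv (QF.twist c q) := by
  refine (hp.twist hc).equiv_of_linearMap (congrArg₂ (· + ·) hdim hdim)
    ((finSplit F q.dim q.dim).symm.toLinearMap ∘ₗ f.prod g ∘ₗ
      (finSplit F p.dim p.dim).toLinearMap) fun w => ?_
  obtain ⟨u, v, rfl⟩ := exists_eq_pair p ((-c) • p) w
  have hsplit : finSplit F p.dim p.dim (pair p ((-c) • p) u v) = (u, v) :=
    (finSplit F p.dim p.dim).apply_symm_apply (u, v)
  refine Eq.trans ?_ ((form_twist_pair c q (f (u, v)) (g (u, v))).trans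
    ((h u v).trans (form_twist_pair c p u v).symm))
  exact congrArg (fun x => (QF.twist c q).form (pair q ((-c) • q) (f x) (g x))) hsplit

theorem twist_one_binary_equiv {α : F} (hα : 1 - 4 * α ≠ 0) :
    (twist 1 (binary α)).Equiv (twist 1 (hyp F)) := by
  let f : ((Fin 2 → F) × (Fin 2 → F)) →ₗ[F] (Fin 2 → F) :=
    planeMap 1 0 1 1 ∘ₗ (LinearMap.fst F _ _ - LinearMap.snd F _ _) +
      planeMap 0 0 2 1 ∘ₗ LinearMap.snd F _ _
  let g : ((Fin 2 → F) × (Fin 2 → F)) →ₗ[F] (Fin 2 → F) :=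
    planeMap 0 1 0 (-α) ∘ₗ (LinearMap.fst F _ _ - LinearMap.snd F _ _) +
      planeMap 0 0 (-1) (-(2 * α)) ∘ₗ LinearMap.snd F _ _
  refine (binary_regular hα).twist_equiv_of_linearMap (q := hyp F) rfl one_ne_zero f g
    fun (u : Fin 2 → F) (v : Fin 2 → F) => ?_
  refine (congrArg₂ (· + -1 * ·) (hyp_apply (f (u, v))) (hyp_apply (g (u, v)))).trans ?_
  rw [binary_apply α u, binary_apply α v]
  simp only [f, g, LinearMap.add_apply, LinearMap.comp_apply, LinearMap.sub_apply,
    LinearMap.fst_apply, LinearMap.snd_apply, planeMap_apply_zero, planeMap_apply_one,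
    Pi.add_apply, Pi.sub_apply]
  ring

theorem binary_equiv_twist_unit (h2 : (2 : F) ≠ 0) {c : F} (hc : c ≠ 0) :
    (binary ((1 - c) / 4)).Equiv (twist c (unit F)) := by
  have h4 : (4 : F) ≠ 0 := by
    rw [show (4 : F) = 2 * 2 by norm_num]
    exact mul_ne_zero h2 h2
  have hα : 1 - 4 * ((1 - c) / 4) ≠ 0 := by
    field_simp
    simpa using hc
  let f : (Fin 2 → F) →ₗ[F] (Fin 1 → F) :=
    LinearMap.pi fun _ => LinearMap.proj 0 + (2 : F)⁻¹ • LinearMap.proj 1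
  let g : (Fin 2 → F) →ₗ[F] (Fin 1 → F) := LinearMap.pi fun _ => (2 : F)⁻¹ • LinearMap.proj 1
  refine (binary_regular hα).equiv_of_linearMap rfl
    ((finSplit F 1 1).symm.toLinearMap ∘ₗ f.prod g) fun (v : Fin 2 → F) => ?_
  refine (form_twist_pair c (unit F) (f v) (g v)).trans ?_
  rw [binary_apply _ v]
  have hunit (u : Fin 1 → F) : (unit F).form u = u 0 * u 0 := rfl
  rw [hunit, hunit]
  simp only [f, g, LinearMap.pi_apply, LinearMap.add_apply, LinearMap.smul_apply,
    LinearMap.proj_apply, smul_eq_mul]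
  have h44 : (4 : F)⁻¹ = 2⁻¹ * 2⁻¹ := by rw [← mul_inv]; norm_num
  have h22 : (2 : F) * 2⁻¹ = 1 := mul_inv_cancel₀ h2
  rw [div_eq_mul_inv, h44]
  linear_combination (v 0 * v 1) * h22

/-- Quadratic Pfister forms have a uniform presentation in all characteristics. -/
theorem IsQPfister.exists_binary {n : ℕ} (hn : 1 ≤ n) {q : QF F} (h : IsQPfister n q) :
    ∃ (l : List F) (α : F), UnitList l ∧ l.length + 1 = n ∧ 1 - 4 * α ≠ 0 ∧
      (btensor l (binary α)).Equiv q := by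
  unfold IsQPfister at h
  split_ifs at h with h2
  · obtain ⟨l, α, hl, hlen, e⟩ := h
    refine ⟨l, α, hl, hlen, ?_, e⟩
    have : CharP F 2 := h2 ▸ ringChar.charP F
    have h20 : (2 : F) = 0 := CharTwo.two_eq_zero
    rw [show (4 : F) = 2 * 2 by norm_num, h20]
    simp
  · obtain ⟨l, hl, hlen, e⟩ := h
    have h20 : (2 : F) ≠ 0 := Ring.two_ne_zero h2
    obtain ⟨l', c, rfl⟩ := (List.eq_nil_or_concat' l).resolve_left
      (by rintro rfl; simp at hlen; omega)
    rw [unitList_append] at hl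
    have hc : c ≠ 0 := hl.2 c (by simp)
    refine ⟨l', (1 - c) / 4, hl.1, by simpa using hlen, ?_, ?_⟩
    · have h4 : (4 : F) ≠ 0 := by
        rw [show (4 : F) = 2 * 2 by norm_num]
        exact mul_ne_zero h20 h20
      rw [mul_div_cancel₀ _ h4]
      simpa using hc
    · rw [btensor_append] at e
      exact ((binary_equiv_twist_unit h20 hc).btensor l').trans e

/-- The hyperbolic `(m + 1)`-fold Pfister form `⟨⟨1, …, 1⟩⟩ ⊗ ℍ`. -/
def hypPfister (F : Type) [Field F] (m : ℕ) : QF F := btensor (List.replicate m 1) (hyp F)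

theorem smul_hypPfister_equiv {c : F} (hc : c ≠ 0) (m : ℕ) :
    (c • hypPfister F m).Equiv (hypPfister F m) := by
  rw [← cls_eq_cls]
  induction m with
  | zero => exact cls_eq_cls.mpr (smul_hyp_equiv hc)
  | succ m ih =>
    change c • cls (twist 1 (hypPfister F m)) = cls (twist 1 (hypPfister F m))
    rw [cls_smul] at ih
    rw [cls_twist, smul_add, smul_comm, ih]

theorem twist_hypPfister_equiv {c : F} (hc : c ≠ 0) (m : ℕ) :
    (twist c (hypPfister F m)).Equiv (hypPfister F (m + 1)) := by
  change (twist c (hypPfister F m)).Equiv (twist 1 (hypPfister F m))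
  rw [← cls_eq_cls, cls_twist, cls_twist, ← cls_smul, ← cls_smul,
    cls_eq_cls.mpr (smul_hypPfister_equiv (neg_ne_zero.mpr hc) m),
    cls_eq_cls.mpr (smul_hypPfister_equiv (neg_ne_zero.mpr one_ne_zero) m)]

theorem btensor_equiv_hypPfister {l : List F} (hl : UnitList l) {q : QF F} {m : ℕ}
    (h : q.Equiv (hypPfister F m)) : (btensor l q).Equiv (hypPfister F (m + l.length)) := by
  induction l with
  | nil => exact h
  | cons c l ih =>
    rw [unitList_cons] at hl
    exact ((ih hl.2).twist c).trans (twist_hypPfister_equiv hl.1 _)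

theorem twist_one_btensor_binary_equiv {l : List F} (hl : UnitList l) {α : F}
    (hα : 1 - 4 * α ≠ 0) :
    (twist 1 (btensor l (binary α))).Equiv (hypPfister F (l.length + 1)) := by
  rw [add_comm]
  exact (twist_btensor 1 l _).trans
    (btensor_equiv_hypPfister (m := 1) hl (twist_one_binary_equiv hα))

theorem Round.twist_equiv_twist_one {q : QF F} (hround : q.Round) (hq : q.form.Anisotropic) {c : F}
    (hc : c ≠ 0) (h : ¬ (QF.twist c q).form.Anisotropic) :
    (QF.twist c q).Equiv (QF.twist 1 q) := by
  simp only [QuadraticMap.Anisotropic, not_forall] at h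
  obtain ⟨w, hw, hw0⟩ := h
  obtain ⟨u, v, rfl⟩ := exists_eq_pair q ((-c) • q) w
  replace hw : q.form u + -c * q.form v = 0 := (form_twist_pair c q u v).symm.trans hw
  have hv : q.form v ≠ 0 := by
    intro hv
    rw [hv, mul_zero, add_zero] at hw
    have hu0 := hq u hw
    have hv0 := hq v hv
    subst hu0
    subst hv0
    exact hw0 (pair_zero q ((-c) • q))
  have hu : q.form u = c * q.form v := by linear_combination hw
  have hu0 : q.form u ≠ 0 := hu ▸ mul_ne_zero hc hv
  have e₁ := cls_eq_cls.mpr (hround u hu0)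
  have e₂ := cls_eq_cls.mpr (hround v hv)
  rw [hu, cls_smul, mul_smul, ← cls_smul, e₂] at e₁
  rw [← cls_eq_cls, cls_twist, cls_twist, ← neg_one_mul c, mul_smul, e₁]

theorem isotropic_btensor_binary {l : List F} (hl : UnitList l) {α : F} (hα : 1 - 4 * α ≠ 0)
    (h : ¬ (btensor l (binary α)).form.Anisotropic) :
    (btensor l (binary α)).Equiv (hypPfister F l.length) := by
  induction l with
  | nil => exact binary_equiv_hyp hα h
  | cons c l ih =>
    rw [unitList_cons] at hl
    by_cases hq : (btensor l (binary α)).form.Anisotropic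
    · exact (((binary_round hα).btensor hl.2).twist_equiv_twist_one hq hl.1 h).trans
        (twist_one_btensor_binary_equiv hl.2 hα)
    · exact ((ih hl.2 hq).twist c).trans (twist_hypPfister_equiv hl.1 _)

theorem IsQPfister.equiv_hypPfister {m : ℕ} {q : QF F} (h : IsQPfister (m + 1) q)
    (hq : ¬ q.form.Anisotropic) : q.Equiv (hypPfister F m) := by
  obtain ⟨l, α, hl, hlen, hα, e⟩ := h.exists_binary (by omega)
  obtain rfl : l.length = m := by omega
  refine e.symm.trans (isotropic_btensor_binary hl hα fun h => hq fun v hv => ?_)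
  obtain ⟨e⟩ := e
  have h0 := h (e.symm v) ((e.symm.map_app v).trans hv)
  rw [← e.apply_symm_apply v, h0]
  exact map_zero e.toLinearEquiv

theorem IsQPfister.btensor_replicate_one_equiv {k m : ℕ} {q : QF F} (h : IsQPfister (k + 1) q) :
    (btensor (List.replicate (m + 1) 1) q).Equiv (hypPfister F (k + (m + 1))) := by
  obtain ⟨l, α, hl, hlen, hα, e⟩ := h.exists_binary (by omega)
  obtain rfl : l.length = k := by omega
  have h1 : UnitList (List.replicate m (1 : F)) := fun c hc => by
    rw [List.eq_of_mem_replicate hc]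
    exact one_ne_zero
  refine (e.symm.btensor _).trans ?_
  have h2 := (twist_btensor 1 (List.replicate m (1 : F)) (btensor l (binary α))).trans
    (btensor_equiv_hypPfister h1 (twist_one_btensor_binary_equiv hl hα))
  rw [List.length_replicate, add_assoc, add_comm 1 m] at h2
  exact h2

theorem IsQPfister.dim_eq {n : ℕ} (hn : 1 ≤ n) {q : QF F} (h : IsQPfister n q) :
    q.dim = 2 ^ n := by
  obtain ⟨l, α, -, rfl, -, e⟩ := h.exists_binary hn
  rw [← e.dim_eq, dim_btensor, pow_succ]
  rfl

theorem IsQPfister.round {n : ℕ} (hn : 1 ≤ n) {q : QF F} (h : IsQPfister n q) : q.Round := by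
  obtain ⟨l, α, hl, -, hα, e⟩ := h.exists_binary hn
  exact ((binary_round hα).btensor hl).congr e

theorem IsQPfister.regular {n : ℕ} (hn : 1 ≤ n) {q : QF F} (h : IsQPfister n q) :
    q.Regular := by
  obtain ⟨l, α, hl, -, hα, e⟩ := h.exists_binary hn
  exact ((binary_regular hα).btensor hl).congr e

theorem IsQPfister.exists_form_eq_one {n : ℕ} (hn : 1 ≤ n) {q : QF F} (h : IsQPfister n q) :
    ∃ v, q.form v = 1 := by
  obtain ⟨l, α, -, -, -, ⟨e⟩⟩ := h.exists_binary hn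
  obtain ⟨v, hv⟩ : ∃ v, (btensor l (binary α)).form v = 1 := by
    clear e
    induction l with
    | nil => exact binary_form_eq_one α
    | cons c l ih => exact exists_form_twist_eq_one ih c
  exact ⟨e v, (e.map_app v).trans hv⟩

theorem IsQPfisterFactor.exists_length_eq {n k : ℕ} (hk : 1 ≤ k) (hn : 1 ≤ n) {φ ψ : QF F}
    (h : IsQPfisterFactor k φ ψ) (hψ : IsQPfister n ψ) :
    ∃ l : List F, UnitList l ∧ l.length = n - k ∧ (btensor l φ).Equiv ψ := by
  obtain ⟨hφ, l, hl, e⟩ := h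
  refine ⟨l, hl, ?_, e⟩
  have hd := e.dim_eq
  rw [dim_btensor, hφ.dim_eq hk, hψ.dim_eq hn, ← pow_add] at hd
  have := Nat.pow_right_injective le_rfl hd
  omega

end QF

/-- Given integers `n > k ≥ 1`, a quadratic `n`-fold Pfister form `ψ`
over a field `F`, and two `k`-fold quadratic Pfister forms `φ₁`, `φ₂` which are both
Pfister factors of `ψ`, there exists a single `(n−k)`-fold bilinear Pfister form `ρ`
such that `ψ ≅ ρ ⊗ φ₁` and `ψ ≅ ρ ⊗ φ₂`. -/
theorem common_bilinear_complement
    (F : Type) [Field F] (n k : ℕ) (hk : 1 ≤ k) (hkn : k < n)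
    (ψ φ₁ φ₂ : QF F)
    (hψ : QF.IsQPfister n ψ)
    (h₁ : QF.IsQPfisterFactor k φ₁ ψ) (h₂ : QF.IsQPfisterFactor k φ₂ ψ) :
    ∃ ρ : List F, QF.UnitList ρ ∧ ρ.length = n - k ∧
      (QF.btensor ρ φ₁).Equiv ψ ∧ (QF.btensor ρ φ₂).Equiv ψ := by
  by_cases hq : ψ.form.Anisotropic
  · obtain ⟨l₁, hl₁, hm₁, e₁⟩ := h₁.exists_length_eq hk (by omega) hψ
    obtain ⟨l₂, hl₂, hm₂, e₂⟩ := h₂.exists_length_eq hk (by omega) hψ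
    exact QF.exists_common_complement_of_anisotropic hq (h₁.1.round hk) (h₂.1.round hk)
      (h₁.1.regular hk) (h₂.1.regular hk) (h₁.1.exists_form_eq_one hk)
      (h₂.1.exists_form_eq_one hk) hl₁ hl₂ hm₁ hm₂ e₁ e₂
  · obtain ⟨j, rfl⟩ := Nat.exists_eq_add_of_le' hk
    obtain ⟨m, rfl⟩ := Nat.exists_eq_add_of_lt hkn
    have hψ' := QF.IsQPfister.equiv_hypPfister (m := j + (m + 1))
      (by rwa [show j + (m + 1) + 1 = j + 1 + m + 1 by omega]) hq
    refine ⟨List.replicate (m + 1) 1, fun c hc => ?_, ?_, ?_, ?_⟩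
    · rw [List.eq_of_mem_replicate hc]
      exact one_ne_zero
    · rw [List.length_replicate]
      omega
    · exact h₁.1.btensor_replicate_one_equiv.trans hψ'.symm
    · exact h₂.1.btensor_replicate_one_equiv.trans hψ'.symm
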